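/- (Proposition 2.1, mass part.) Let u : ℝ → (Fin N → ℝ) be such that for every t ∈ ℝ the ℂ^N-valued function t ↦ (u(t) : Fin N → ℂ) has derivative f_M(u(t)) = B_{HS2}u(t) − (1/(m+1))·(u(t)^{∘(m−1)} ⊙ (B_{S1}u(t)) + B_{S1}(u(t)^{∘m})) at t. Then the semi-discrete mass is conserved: ⟨u(t), u(t)⟩_h = ⟨u(0), u(0)⟩_h for all t ∈ ℝ. -/

import Mathlib

open Matrix Complex BigOperators

noncomputable section

/-- The shifted integer index `k̂ = k - N/2` associated to `k ∈ Fin N`. -/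
def khat (N : ℕ) (k : Fin N) : ℤ := (k : ℤ) - (N : ℤ) / 2

/-- The collocation angles `θ_j = 2π ĵ / N`. -/
def theta (N : ℕ) (j : Fin N) : ℝ := 2 * Real.pi * (khat N j : ℝ) / N

/-- The discrete Fourier matrix `F`, `F_{k,j} = (1/N) exp(-i k̂ θ_j)`. -/
def Fm (N : ℕ) : Matrix (Fin N) (Fin N) ℂ :=
  Matrix.of fun k j => (N : ℂ)⁻¹ * Complex.exp (-Complex.I * (khat N k : ℂ) * (theta N j : ℂ))

/-- The inverse discrete Fourier matrix `G`, `G_{j,k} = exp(i k̂ θ_j)`. -/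
def Gm (N : ℕ) : Matrix (Fin N) (Fin N) ℂ :=
  Matrix.of fun j k => Complex.exp (Complex.I * (khat N k : ℂ) * (theta N j : ℂ))

/-- The diagonal weight matrix `P = diag(α - i x_j)`. -/
def Pm (N : ℕ) (α : ℝ) (x : Fin N → ℝ) : Matrix (Fin N) (Fin N) ℂ :=
  Matrix.diagonal fun j => (α : ℂ) - Complex.I * (x j : ℂ)

/-- The diagonal matrix `P⁻¹ = diag((α - i x_j)⁻¹)`. -/
def PinvM (N : ℕ) (α : ℝ) (x : Fin N → ℝ) : Matrix (Fin N) (Fin N) ℂ :=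
  Matrix.diagonal fun j => ((α : ℂ) - Complex.I * (x j : ℂ))⁻¹

/-- The diagonal matrix `P̄ = diag(α + i x_j)`. -/
def PbarM (N : ℕ) (α : ℝ) (x : Fin N → ℝ) : Matrix (Fin N) (Fin N) ℂ :=
  Matrix.diagonal fun j => (α : ℂ) + Complex.I * (x j : ℂ)

/-- The discrete Hilbert transform matrix `H = diag(-i sgn(k̂))` with `sgn(0) = 1`. -/
def Hm (N : ℕ) : Matrix (Fin N) (Fin N) ℂ :=
  Matrix.diagonal fun k => if 0 ≤ khat N k then -Complex.I else Complex.I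

/-- The tridiagonal differentiation matrix `S1`:
`(S1)_{k,k-1} = i k̂/(2α)`, `(S1)_{k,k} = i (2k̂+1)/(2α)`, `(S1)_{k,k+1} = i (k̂+1)/(2α)`. -/
def S1 (N : ℕ) (α : ℝ) : Matrix (Fin N) (Fin N) ℂ :=
  Matrix.of fun k l =>
    if (l : ℤ) = (k : ℤ) - 1 then Complex.I * (khat N k : ℂ) / (2 * (α : ℂ))
    else if (l : ℤ) = (k : ℤ) then Complex.I * (2 * (khat N k : ℂ) + 1) / (2 * (α : ℂ))
    else if (l : ℤ) = (k : ℤ) + 1 then Complex.I * ((khat N k : ℂ) + 1) / (2 * (α : ℂ))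
    else 0

/-- The second-derivative matrix `S2 = S1 · S1`. -/
def S2 (N : ℕ) (α : ℝ) : Matrix (Fin N) (Fin N) ℂ := S1 N α * S1 N α

/-- The discrete inner product `⟨u,v⟩_h = (π/(Nα)) Σ_j (α² + x_j²) u_j conj(v_j)`. -/
def iph (N : ℕ) (α : ℝ) (x : Fin N → ℝ) (u v : Fin N → ℂ) : ℂ :=
  ((Real.pi / (N * α) : ℝ) : ℂ) *
    ∑ j, ((α ^ 2 + x j ^ 2 : ℝ) : ℂ) * u j * (starRingEnd ℂ) (v j)

/-- The conjugated first-derivative operator `B_{S1} = P⁻¹ G S1 F P`. -/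
def BS1 (N : ℕ) (α : ℝ) (x : Fin N → ℝ) : Matrix (Fin N) (Fin N) ℂ :=
  PinvM N α x * Gm N * S1 N α * Fm N * Pm N α x

/-- The conjugated operator `B_{HS1} = P⁻¹ G H S1 F P`. -/
def BHS1 (N : ℕ) (α : ℝ) (x : Fin N → ℝ) : Matrix (Fin N) (Fin N) ℂ :=
  PinvM N α x * Gm N * Hm N * S1 N α * Fm N * Pm N α x

/-- The conjugated dispersion operator `B_{HS2} = P⁻¹ G H S2 F P`. -/
def BHS2 (N : ℕ) (α : ℝ) (x : Fin N → ℝ) : Matrix (Fin N) (Fin N) ℂ :=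
  PinvM N α x * Gm N * Hm N * S2 N α * Fm N * Pm N α x

/-- Coercion of a real vector into a complex vector. -/
def cv (N : ℕ) (u : Fin N → ℝ) : Fin N → ℂ := fun j => (u j : ℂ)

/-- Entrywise `m`-th power of a complex vector. -/
def pw (N : ℕ) (m : ℕ) (u : Fin N → ℂ) : Fin N → ℂ := fun j => u j ^ m

/-- The mass-conservative semi-discrete right-hand side
`f_M(w) = B_{HS2} w - (1/(m+1)) (w^{∘(m-1)} ⊙ (B_{S1} w) + B_{S1}(w^{∘m}))`. -/
def fM (N : ℕ) (α : ℝ) (x : Fin N → ℝ) (m : ℕ) (w : Fin N → ℂ) : Fin N → ℂ :=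
  fun j => (BHS2 N α x *ᵥ w) j
    - (1 / ((m : ℂ) + 1)) *
        ((w j) ^ (m - 1) * (BS1 N α x *ᵥ w) j + (BS1 N α x *ᵥ pw N m w) j)

/-- The energy-conservative semi-discrete right-hand side
`f_E(w) = -B_{S1}(-B_{HS1} w + (1/m) w^{∘m})`. -/
def fE (N : ℕ) (α : ℝ) (x : Fin N → ℝ) (m : ℕ) (w : Fin N → ℂ) : Fin N → ℂ :=
  -(BS1 N α x *ᵥ (-(BHS1 N α x *ᵥ w) + (1 / (m : ℂ)) • pw N m w))

/-- The semi-discrete energy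
`E_h(w) = (1/2)⟨B_{HS1} w, w⟩_h - (1/(m(m+1)))⟨w^{∘m}, w⟩_h`. -/
def Eh (N : ℕ) (α : ℝ) (x : Fin N → ℝ) (m : ℕ) (w : Fin N → ℂ) : ℂ :=
  (1 / 2 : ℂ) * iph N α x (BHS1 N α x *ᵥ w) w
    - (1 / ((m : ℂ) * ((m : ℂ) + 1))) * iph N α x (pw N m w) w

end

theorem Fm_eq_smul_conjTranspose_Gm (N : ℕ) : Fm N = (N : ℂ)⁻¹ • (Gm N)ᴴ := by
  ext k j
  simp [Fm, Gm, Matrix.conjTranspose_apply, ← Complex.exp_conj]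

theorem conjTranspose_S1 (N : ℕ) (α : ℝ) : (S1 N α)ᴴ = -S1 N α := by
  ext k l
  simp only [S1, Matrix.conjTranspose_apply, Matrix.of_apply, Matrix.neg_apply]
  rcases lt_trichotomy (l : ℤ) (k : ℤ) with h | h | h
  · by_cases h1 : (l : ℤ) = (k : ℤ) - 1
    · have hk : (khat N k : ℂ) = (khat N l : ℂ) + 1 := by
        have : khat N k = khat N l + 1 := by simp only [khat]; lia
        rw [this]; push_cast; ring
      rw [if_neg (by lia), if_neg (by lia), if_pos (by lia), if_pos h1, hk]
      simp [neg_div]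
    · rw [if_neg (by lia), if_neg (by lia), if_neg (by lia), if_neg (by lia), if_neg (by lia),
        if_neg (by lia)]
      simp
  · obtain rfl : l = k := by ext; exact_mod_cast h
    rw [if_neg (by lia), if_pos rfl]
    simp [neg_div]
  · by_cases h1 : (l : ℤ) = (k : ℤ) + 1
    · have hk : (khat N l : ℂ) = (khat N k : ℂ) + 1 := by
        have : khat N l = khat N k + 1 := by simp only [khat]; lia
        rw [this]; push_cast; ring
      rw [if_pos (by lia), if_neg (by lia), if_neg (by lia), if_pos h1, hk]
      simp [neg_div]
    · rw [if_neg (by lia), if_neg (by lia), if_neg (by lia), if_neg (by lia), if_neg (by lia),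
        if_neg (by lia)]
      simp

theorem conjTranspose_Hm (N : ℕ) : (Hm N)ᴴ = -Hm N := by
  rw [Hm, Matrix.diagonal_conjTranspose, Matrix.diagonal_neg]
  congr 1
  ext k
  by_cases h : 0 ≤ khat N k <;> simp [h]

/-- The entries of `S1` coupling nonnegative and negative frequencies vanish, so `S1` commutes
with the discrete Hilbert transform. -/
theorem commute_Hm_S1 (N : ℕ) (α : ℝ) : Commute (Hm N) (S1 N α) := by
  have hz : ∀ k l : Fin N, ¬(0 ≤ khat N k ↔ 0 ≤ khat N l) → S1 N α k l = 0 := by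
    intro k l h
    simp only [S1, Matrix.of_apply]
    split_ifs with h1 h2 h3
    · have : khat N k = 0 := by simp only [khat] at *; lia
      simp [this]
    · simp only [khat] at h; lia
    · have : khat N k = -1 := by simp only [khat] at *; lia
      simp [this]
    · rfl
  ext k l
  rw [Hm, Matrix.diagonal_mul, Matrix.mul_diagonal]
  by_cases h : 0 ≤ khat N k ↔ 0 ≤ khat N l
  · simp only [h, mul_comm]
  · rw [hz k l h, mul_zero, zero_mul]

theorem conjTranspose_Hm_mul_S2 (N : ℕ) (α : ℝ) : (Hm N * S2 N α)ᴴ = -(Hm N * S2 N α) := by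
  have hc : Commute (Hm N) (S2 N α) := (commute_Hm_S1 N α).mul_right (commute_Hm_S1 N α)
  have hS : (S2 N α)ᴴ = S2 N α := by
    simp [S2, Matrix.conjTranspose_mul, conjTranspose_S1]
  rw [Matrix.conjTranspose_mul, hS, conjTranspose_Hm, Matrix.mul_neg, hc.eq]

theorem Pm_mul_PinvM (N : ℕ) {α : ℝ} (hα : α ≠ 0) (x : Fin N → ℝ) :
    Pm N α x * PinvM N α x = 1 := by
  rw [Pm, PinvM, Matrix.diagonal_mul_diagonal, ← Matrix.diagonal_one]
  congr 1
  ext j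
  refine mul_inv_cancel₀ fun h => hα ?_
  simpa using congrArg Complex.re h

theorem iph_eq_dotProduct (N : ℕ) (α : ℝ) (x : Fin N → ℝ) (u v : Fin N → ℂ) :
    iph N α x u v =
      ((Real.pi / (N * α) : ℝ) : ℂ) * (star (Pm N α x *ᵥ v) ⬝ᵥ (Pm N α x *ᵥ u)) := by
  rw [iph, dotProduct]
  congr 1
  refine Finset.sum_congr rfl fun j _ => ?_
  simp only [Pm, Matrix.mulVec_diagonal, Pi.star_apply, star_mul', star_sub, RCLike.star_def,
    Complex.conj_ofReal, Complex.conj_I]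
  push_cast
  linear_combination ((x j : ℂ) ^ 2 * u j * (starRingEnd ℂ) (v j)) * Complex.I_sq

theorem star_iph (N : ℕ) (α : ℝ) (x : Fin N → ℝ) (u v : Fin N → ℂ) :
    star (iph N α x u v) = iph N α x v u := by
  simp only [iph, star_mul', star_sum, RCLike.star_def, Complex.conj_ofReal, Complex.conj_conj]
  congr 1
  exact Finset.sum_congr rfl fun j _ => by ring

/-- Conjugating a skew-Hermitian matrix by the weighted discrete Fourier transform gives an operator
that is skew-adjoint for the discrete inner product. -/
theorem iph_mulVec_of_skew (N : ℕ) {α : ℝ} (hα : α ≠ 0) (x : Fin N → ℝ)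
    {A : Matrix (Fin N) (Fin N) ℂ} (hA : Aᴴ = -A) (u v : Fin N → ℂ) :
    iph N α x ((PinvM N α x * Gm N * A * Fm N * Pm N α x) *ᵥ u) v =
      -iph N α x u ((PinvM N α x * Gm N * A * Fm N * Pm N α x) *ᵥ v) := by
  have hK : (Gm N * A * Fm N)ᴴ = -(Gm N * A * Fm N) := by
    simp [Fm_eq_smul_conjTranspose_Gm, Matrix.conjTranspose_mul, hA, Matrix.mul_assoc]
  have hP : ∀ w, Pm N α x *ᵥ ((PinvM N α x * Gm N * A * Fm N * Pm N α x) *ᵥ w) =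
      (Gm N * A * Fm N) *ᵥ (Pm N α x *ᵥ w) := by
    intro w
    rw [Matrix.mulVec_mulVec, Matrix.mulVec_mulVec]
    congr 1
    simp only [← Matrix.mul_assoc, Pm_mul_PinvM N hα x, Matrix.one_mul]
  rw [iph_eq_dotProduct, iph_eq_dotProduct, hP, hP, Matrix.star_mulVec (Gm N * A * Fm N), hK, Matrix.vecMul_neg, neg_dotProduct, mul_neg,
    neg_neg, ← Matrix.dotProduct_mulVec]

theorem iph_BS1_mulVec (N : ℕ) {α : ℝ} (hα : α ≠ 0) (x : Fin N → ℝ) (u v : Fin N → ℂ) :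
    iph N α x (BS1 N α x *ᵥ u) v = -iph N α x u (BS1 N α x *ᵥ v) :=
  iph_mulVec_of_skew N hα x (conjTranspose_S1 N α) u v

theorem iph_BHS2_mulVec (N : ℕ) {α : ℝ} (hα : α ≠ 0) (x : Fin N → ℝ) (u v : Fin N → ℂ) :
    iph N α x (BHS2 N α x *ᵥ u) v = -iph N α x u (BHS2 N α x *ᵥ v) := by
  have h := iph_mulVec_of_skew N hα x (conjTranspose_Hm_mul_S2 N α) u v
  rwa [← Matrix.mul_assoc (PinvM N α x * Gm N)] at h

theorem iph_fM (N : ℕ) (α : ℝ) (x : Fin N → ℝ) {m : ℕ} (hm : 1 ≤ m) (u : Fin N → ℝ) :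
    iph N α x (fM N α x m (cv N u)) (cv N u) =
      iph N α x (BHS2 N α x *ᵥ cv N u) (cv N u) - (1 / ((m : ℂ) + 1)) *
        (iph N α x (BS1 N α x *ᵥ cv N u) (pw N m (cv N u)) +
          iph N α x (BS1 N α x *ᵥ pw N m (cv N u)) (cv N u)) := by
  obtain ⟨n, rfl⟩ := Nat.exists_eq_add_of_le' hm
  simp only [iph, ← mul_add, ← Finset.sum_add_distrib]
  rw [mul_left_comm, ← mul_sub, Finset.mul_sum (a := 1 / _), ← Finset.sum_sub_distrib]
  congr 1
  refine Finset.sum_congr rfl fun j _ => ?_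
  simp only [fM, pw, cv, Nat.add_sub_cancel, map_pow, Complex.conj_ofReal]
  ring

/-- The right-hand side `f_M` is orthogonal (in real part) to real states. -/
theorem iph_fM_add_iph_fM (N : ℕ) {α : ℝ} (hα : α ≠ 0) (x : Fin N → ℝ) {m : ℕ} (hm : 1 ≤ m)
    (u : Fin N → ℝ) :
    iph N α x (fM N α x m (cv N u)) (cv N u) + iph N α x (cv N u) (fM N α x m (cv N u)) = 0 := by
  rw [← star_iph N α x (fM N α x m (cv N u)), iph_fM N α x hm, iph_BS1_mulVec N hα x (pw N m _)]
  simp only [star_sub, star_mul', star_add, star_neg, star_iph]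
  rw [iph_BHS2_mulVec N hα x]
  have hc : star (1 / ((m : ℂ) + 1)) = 1 / ((m : ℂ) + 1) := by simp
  rw [hc]
  ring

theorem HasDerivAt.iph_self {N : ℕ} {α : ℝ} {x : Fin N → ℝ} {w : ℝ → Fin N → ℂ}
    {w' : Fin N → ℂ} {t : ℝ} (hw : HasDerivAt w w' t) :
    HasDerivAt (fun s => iph N α x (w s) (w s)) (iph N α x w' (w t) + iph N α x (w t) w') t := by
  have hj := hasDerivAt_pi.1 hw
  have h := (HasDerivAt.fun_sum (u := Finset.univ) fun j _ =>
    ((hj j).const_mul ((α ^ 2 + x j ^ 2 : ℝ) : ℂ)).mul (hj j).star).const_mul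
      ((Real.pi / (N * α) : ℝ) : ℂ)
  refine h.congr_deriv ?_
  simp only [iph, ← mul_add, ← Finset.sum_add_distrib]
  rfl

/-- Proposition 2.1 (mass part): any real solution of the semi-discrete system
`u_t = f_M(u)` conserves the semi-discrete mass `⟨u, u⟩_h`. -/
theorem semidiscrete_mass_conservation (N : ℕ) (hN : Even N) (hN0 : 0 < N)
    (α : ℝ) (hα : 0 < α) (x : Fin N → ℝ) (m : ℕ) (hm : 1 ≤ m)
    (u : ℝ → Fin N → ℝ)
    (hu : ∀ t : ℝ, HasDerivAt (fun s => cv N (u s)) (fM N α x m (cv N (u t))) t) :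
    ∀ t : ℝ, iph N α x (cv N (u t)) (cv N (u t)) = iph N α x (cv N (u 0)) (cv N (u 0)) := by
  intro t
  refine is_const_of_deriv_eq_zero (fun s => ((hu s).iph_self).differentiableAt) (fun s => ?_) t 0
  rw [(hu s).iph_self.deriv, iph_fM_add_iph_fM N hα.ne' x hm]
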